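/- arXiv:1305.6725 — 2 statements merged into one kernel-verified Lean document; each statement's English description precedes it below -/
import Mathlib

section
/- Let ν̃ be a finite measure on ℝ with ∫_ℝ |y| ν̃(dy) < ∞, let L, K > 0, and let ρ : ℝ → [0,∞) be L-Lipschitz with ρ(0) ≤ K. Let m be a positive integer and let ρ̄_m be the grid discretization of ρ with respect to ν̃. Then ∫_ℝ |ρ(y) − ρ̄_m(y)| ν̃(dy) ≤ (L/m)·ν̃({y : 1/m < |y| ≤ m}) + 2∫_{|y| > m} (K + L|y|) ν̃(dy) + ∫_{|y| ≤ 1/m} (K + L|y| + 1) ν̃(dy). -/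
open MeasureTheory

/-- The grid cell of the partition of level `m` containing the point `y`:
`J_{-∞} = (-∞, -m]` if `y ≤ -m`, `J_∞ = (m, ∞)` if `y > m`, and otherwise the unique
grid interval `J_{j,k} = (k + (j-1)/m, k + j/m] = ((i-1)/m, i/m]` (with `i = ⌈my⌉`)
containing `y`. -/
noncomputable def gridCell (m : ℕ) (y : ℝ) : Set ℝ :=
  if y ≤ -(m : ℝ) then Set.Iic (-(m : ℝ))
  else if (m : ℝ) < y then Set.Ioi (m : ℝ)
  else Set.Ioc ((((⌈(m : ℝ) * y⌉ : ℤ) : ℝ) - 1) / m) (((⌈(m : ℝ) * y⌉ : ℤ) : ℝ) / m)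

/-- The grid discretization `ρ̄ₘ` of `ρ` with respect to the measure `ν`: it equals `1`
on `(-1/m, 1/m]`, and on every other grid cell `J` it equals the constant
`ν(J)/ν̃(J) = (∫_J ρ dν̃)/ν̃(J)`, with the convention that it equals `1` on cells of
`ν̃`-measure zero. -/
noncomputable def gridDisc (m : ℕ) (ν : Measure ℝ) (ρ : ℝ → ℝ) (y : ℝ) : ℝ :=
  if y ∈ Set.Ioc (-(1 / (m : ℝ))) (1 / (m : ℝ)) then 1
  else if ν (gridCell m y) = 0 then 1
  else (∫ z in gridCell m y, ρ z ∂ν) / (ν (gridCell m y)).toReal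

theorem avg_mul_aux (ν : Measure ℝ) [IsFiniteMeasure ν] (ρ : ℝ → ℝ) (hi : Integrable ρ ν)
    (J : Set ℝ) (c : ℝ) :
    (ν J).toReal * |c - (∫ z in J, ρ z ∂ν) / (ν J).toReal| = |∫ z in J, (ρ z - c) ∂ν| := by
  rw [integral_sub hi.integrableOn (integrable_const c), setIntegral_const]
  simp only [smul_eq_mul, Measure.real]
  by_cases h : (ν J).toReal = 0
  · have h0 : ν J = 0 := by
      rcases (ENNReal.toReal_eq_zero_iff _).1 h with h | h
      · exact h
      · exact absurd h (measure_ne_top ν J)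
    rw [h, setIntegral_measure_zero _ h0]; simp
  · have hp : 0 < (ν J).toReal := lt_of_le_of_ne ENNReal.toReal_nonneg (Ne.symm h)
    nth_rewrite 1 [← abs_of_pos hp]
    rw [← abs_mul, mul_sub, mul_div_cancel₀ _ h, abs_sub_comm]

theorem avg_L1_aux (ν : Measure ℝ) [IsFiniteMeasure ν] (ρ : ℝ → ℝ) (hi : Integrable ρ ν)
    (J : Set ℝ) (c : ℝ) :
    ∫ y in J, |ρ y - (∫ z in J, ρ z ∂ν) / (ν J).toReal| ∂ν ≤ 2 * ∫ y in J, |ρ y - c| ∂ν := by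
  have e := avg_mul_aux ν ρ hi J c
  set a := (∫ z in J, ρ z ∂ν) / (ν J).toReal
  have h1 : Integrable (fun y => |ρ y - c|) (ν.restrict J) :=
    ((hi.sub (integrable_const c)).abs).integrableOn
  have h2 : Integrable (fun y => |ρ y - a|) (ν.restrict J) :=
    ((hi.sub (integrable_const a)).abs).integrableOn
  have h3 : ∫ y in J, |ρ y - a| ∂ν ≤ ∫ y in J, (|ρ y - c| + |c - a|) ∂ν :=
    integral_mono h2 (h1.add (integrable_const _)) (fun y => abs_sub_le _ _ _)
  rw [integral_add h1 (integrable_const _), setIntegral_const] at h3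
  simp only [smul_eq_mul, Measure.real] at h3
  have h4 : |∫ z in J, (ρ z - c) ∂ν| ≤ ∫ y in J, |ρ y - c| ∂ν := abs_integral_le_integral_abs
  linarith

theorem avg_pt_aux (ν : Measure ℝ) [IsFiniteMeasure ν] (ρ : ℝ → ℝ) (hi : Integrable ρ ν)
    (J : Set ℝ) (hJm : MeasurableSet J) (hJ : ν J ≠ 0) (c C : ℝ)
    (h : ∀ z ∈ J, |ρ z - c| ≤ C) :
    |c - (∫ z in J, ρ z ∂ν) / (ν J).toReal| ≤ C := by
  have e := avg_mul_aux ν ρ hi J c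
  have hp : 0 < (ν J).toReal := ENNReal.toReal_pos hJ (measure_ne_top ν J)
  have h1 : ‖∫ z in J, (ρ z - c) ∂ν‖ ≤ C * ν.real J :=
    norm_setIntegral_le_of_norm_le_const (measure_lt_top ν J) h
  rw [Real.norm_eq_abs, ← e, mul_comm] at h1
  exact le_of_mul_le_mul_right h1 hp

theorem cell_ae_aux (ν : Measure ℝ) (m : ℕ) (hm : 0 < m) : ∀ᵐ y ∂ν, ν (gridCell m y) ≠ 0 := by
  have h0 : ∀ J : Set ℝ, ∀ᵐ y ∂ν, y ∈ J → ν J ≠ 0 := by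
    intro J
    by_cases h : ν J = 0
    · have : ∀ᵐ y ∂ν, y ∉ J := measure_eq_zero_iff_ae_notMem.1 h
      filter_upwards [this] with y hy hy'
      exact absurd hy' hy
    · exact Filter.Eventually.of_forall fun y _ => h
  have h3 : ∀ᵐ y ∂ν, ∀ i : ℤ, y ∈ Set.Ioc (((i : ℝ) - 1) / m) ((i : ℝ) / m) →
      ν (Set.Ioc (((i : ℝ) - 1) / m) ((i : ℝ) / m)) ≠ 0 :=
    ae_all_iff.2 fun i => h0 _
  have hm' : (0 : ℝ) < m := by exact_mod_cast hm
  filter_upwards [h0 (Set.Iic (-(m : ℝ))), h0 (Set.Ioi (m : ℝ)), h3] with y a b c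
  unfold gridCell
  split_ifs with h1 h2
  · exact a h1
  · exact b h2
  · refine c _ ⟨?_, ?_⟩
    · rw [div_lt_iff₀ hm']
      have := Int.ceil_lt_add_one ((m : ℝ) * y)
      linarith
    · rw [le_div_iff₀ hm']
      have := Int.le_ceil ((m : ℝ) * y)
      linarith

/-- Discretization bound in Example 1: for a finite measure `ν̃` with finite first
moment and an `L`-Lipschitz nonnegative `ρ` with `ρ(0) ≤ K`, the `L¹(ν̃)` distance
between `ρ` and its grid discretization `ρ̄ₘ` is at most
`(L/m)·ν̃({1/m < |y| ≤ m}) + 2∫_{|y|>m}(K + L|y|) dν̃ + ∫_{|y|≤1/m}(K + L|y| + 1) dν̃`. -/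
theorem integral_abs_sub_gridDisc_le (ν' : Measure ℝ) [IsFiniteMeasure ν']
    (hmom : Integrable (fun y : ℝ => |y|) ν')
    (L K : ℝ) (hL : 0 < L) (hK : 0 < K)
    (ρ : ℝ → ℝ) (hρ0 : ∀ x, 0 ≤ ρ x)
    (hLip : ∀ x y, |ρ x - ρ y| ≤ L * |x - y|) (hρK : ρ 0 ≤ K)
    (m : ℕ) (hm : 0 < m) :
    ∫ y, |ρ y - gridDisc m ν' ρ y| ∂ν' ≤
      (L / m) * (ν' {y : ℝ | 1 / (m : ℝ) < |y| ∧ |y| ≤ (m : ℝ)}).toReal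
        + 2 * ∫ y in {y : ℝ | (m : ℝ) < |y|}, (K + L * |y|) ∂ν'
        + ∫ y in {y : ℝ | |y| ≤ 1 / (m : ℝ)}, (K + L * |y| + 1) ∂ν' := by
  classical
  have hm' : (0 : ℝ) < m := by exact_mod_cast hm
  have hm1 : (1 : ℝ) ≤ m := by exact_mod_cast hm
  have hinv : 1 / (m : ℝ) ≤ 1 := by rw [div_le_one hm']; exact hm1
  have hinv0 : 0 < 1 / (m : ℝ) := by positivity
  have hcont : Continuous ρ := by
    have : LipschitzWith (Real.toNNReal L) ρ := LipschitzWith.of_dist_le_mul (fun x y => by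
      rw [Real.dist_eq, Real.dist_eq, Real.coe_toNNReal _ hL.le]; exact hLip x y)
    exact this.continuous
  have hgrow : ∀ y, ρ y ≤ K + L * |y| := by
    intro y
    have h := hLip y 0
    rw [sub_zero] at h
    have := le_abs_self (ρ y - ρ 0)
    linarith
  have hKL : Integrable (fun y : ℝ => K + L * |y|) ν' := (integrable_const K).add (hmom.const_mul L)
  have hKL1 : Integrable (fun y : ℝ => K + L * |y| + 1) ν' := hKL.add (integrable_const 1)
  have hi : Integrable ρ ν' := by
    refine hKL.mono' hcont.aestronglyMeasurable (Filter.Eventually.of_forall fun y => ?_)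
    rw [Real.norm_eq_abs, abs_of_nonneg (hρ0 y)]
    exact hgrow y
  set A := Set.Iic (-(m : ℝ)) with hA
  set B := Set.Ioi (m : ℝ) with hB
  set M := {y : ℝ | 1 / (m : ℝ) < |y| ∧ |y| ≤ (m : ℝ)} with hM
  set S := {y : ℝ | |y| ≤ 1 / (m : ℝ)} with hS
  set T := {y : ℝ | (m : ℝ) < |y|} with hT
  have mA : MeasurableSet A := measurableSet_Iic
  have mB : MeasurableSet B := measurableSet_Ioi
  have mS : MeasurableSet S := measurableSet_le (by fun_prop) (by fun_prop)
  have mT : MeasurableSet T := measurableSet_lt (by fun_prop) (by fun_prop)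
  have mM : MeasurableSet M :=
    MeasurableSet.inter (s₁ := {y : ℝ | 1 / (m : ℝ) < |y|}) (s₂ := {y : ℝ | |y| ≤ (m : ℝ)})
      (measurableSet_lt (by fun_prop) (by fun_prop)) (measurableSet_le (by fun_prop) (by fun_prop))
  set a := (∫ z in A, ρ z ∂ν') / (ν' A).toReal with ha
  set b := (∫ z in B, ρ z ∂ν') / (ν' B).toReal with hb
  have ia : Integrable (fun y => |ρ y - a|) ν' := (hi.sub (integrable_const a)).abs
  have ib : Integrable (fun y => |ρ y - b|) ν' := (hi.sub (integrable_const b)).abs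
  have iA := ia.indicator mA
  have iB := ib.indicator mB
  have iM := (integrable_const (μ := ν') (L / (m : ℝ))).indicator mM
  have iS := hKL1.indicator mS
  have key : ∫ y, |ρ y - gridDisc m ν' ρ y| ∂ν' ≤
      ∫ y, (((A.indicator (fun y => |ρ y - a|) y + B.indicator (fun y => |ρ y - b|) y)
        + M.indicator (fun _ => L / (m : ℝ)) y) + S.indicator (fun y => K + L * |y| + 1) y) ∂ν' := by
    refine integral_mono_of_nonneg (Filter.Eventually.of_forall fun y => abs_nonneg _)
      (((iA.add iB).add iM).add iS) ?_
    filter_upwards [cell_ae_aux ν' m hm] with y hy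
    have nA : 0 ≤ A.indicator (fun y => |ρ y - a|) y :=
      Set.indicator_nonneg (fun _ _ => abs_nonneg _) y
    have nB : 0 ≤ B.indicator (fun y => |ρ y - b|) y :=
      Set.indicator_nonneg (fun _ _ => abs_nonneg _) y
    have nM : 0 ≤ M.indicator (fun _ => L / (m : ℝ)) y :=
      Set.indicator_nonneg (fun _ _ => by positivity) y
    have nS : 0 ≤ S.indicator (fun y => K + L * |y| + 1) y :=
      Set.indicator_nonneg (fun _ _ => by positivity) y
    by_cases h1 : y ≤ -(m : ℝ)
    · have hc : gridCell m y = A := by simp [gridCell, h1, hA]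
      have hd : gridDisc m ν' ρ y = a := by
        unfold gridDisc
        rw [if_neg (fun h => by have := h.1; linarith), if_neg hy, hc]
      rw [hd]
      rw [Set.indicator_of_mem (show y ∈ A from h1)] at nA ⊢
      linarith
    by_cases h2 : (m : ℝ) < y
    · have hc : gridCell m y = B := by simp [gridCell, h1, h2, hB]
      have hd : gridDisc m ν' ρ y = b := by
        unfold gridDisc
        rw [if_neg (fun h => by have := h.2; linarith), if_neg hy, hc]
      rw [hd]
      rw [Set.indicator_of_mem (show y ∈ B from h2)] at nB ⊢
      linarith
    by_cases h3 : y ∈ Set.Ioc (-(1 / (m : ℝ))) (1 / (m : ℝ))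
    · have hd : gridDisc m ν' ρ y = 1 := by
        unfold gridDisc
        rw [if_pos h3]
      have hyS : y ∈ S := abs_le.2 ⟨h3.1.le, h3.2⟩
      rw [hd]
      rw [Set.indicator_of_mem hyS] at nS ⊢
      have h4 : |ρ y - 1| ≤ K + L * |y| + 1 := by
        rw [abs_le]
        have := hgrow y
        have := hρ0 y
        have : 0 ≤ L * |y| := by positivity
        constructor <;> linarith
      linarith
    · have hd : gridDisc m ν' ρ y =
          (∫ z in gridCell m y, ρ z ∂ν') / (ν' (gridCell m y)).toReal := by
        unfold gridDisc
        rw [if_neg h3, if_neg hy]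
      have hc : gridCell m y = Set.Ioc ((((⌈(m : ℝ) * y⌉ : ℤ) : ℝ) - 1) / m)
          (((⌈(m : ℝ) * y⌉ : ℤ) : ℝ) / m) := by
        unfold gridCell
        rw [if_neg h1, if_neg h2]
      have h4 : |ρ y - gridDisc m ν' ρ y| ≤ L / m := by
        rw [hd]
        refine avg_pt_aux ν' ρ hi _ (by rw [hc]; exact measurableSet_Ioc) hy _ _ ?_
        intro z hz
        rw [hc] at hz
        have hz1 := hz.1
        have hz2 := hz.2
        rw [div_lt_iff₀ hm'] at hz1
        rw [le_div_iff₀ hm'] at hz2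
        have c1 := Int.ceil_lt_add_one ((m : ℝ) * y)
        have c2 := Int.le_ceil ((m : ℝ) * y)
        refine (hLip z y).trans ?_
        rw [div_eq_mul_one_div L]
        refine mul_le_mul_of_nonneg_left ?_ hL.le
        rw [le_div_iff₀ hm']
        nth_rewrite 1 [← abs_of_pos hm']
        rw [← abs_mul, abs_le]
        constructor <;> linarith
      by_cases h5 : |y| ≤ 1 / (m : ℝ)
      · have hyS : y ∈ S := h5
        have hy' : |y| = 1 / (m : ℝ) := by
          have h6 := abs_le.1 h5
          have : y = -(1 / (m : ℝ)) := by
            by_contra hne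
            exact h3 ⟨lt_of_le_of_ne h6.1 (Ne.symm hne), h6.2⟩
          rw [this, abs_neg, abs_of_pos hinv0]
        rw [Set.indicator_of_mem hyS, hy'] at nS ⊢
        rw [div_eq_mul_one_div L] at h4
        linarith
      · have hyM : y ∈ M := ⟨not_le.1 h5, abs_le.2 ⟨(not_le.1 h1).le, not_lt.1 h2⟩⟩
        rw [Set.indicator_of_mem hyM] at nM ⊢
        linarith
  have e1 : ∫ y, (((A.indicator (fun y => |ρ y - a|) y + B.indicator (fun y => |ρ y - b|) y)
        + M.indicator (fun _ => L / (m : ℝ)) y) + S.indicator (fun y => K + L * |y| + 1) y) ∂ν'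
      = ((∫ y in A, |ρ y - a| ∂ν' + ∫ y in B, |ρ y - b| ∂ν') + (L / m) * (ν' M).toReal)
        + ∫ y in S, (K + L * |y| + 1) ∂ν' := by
    have q1 : Integrable (fun y => A.indicator (fun y => |ρ y - a|) y
        + B.indicator (fun y => |ρ y - b|) y) ν' := iA.add iB
    have q2 : Integrable (fun y => (A.indicator (fun y => |ρ y - a|) y
        + B.indicator (fun y => |ρ y - b|) y) + M.indicator (fun _ => L / (m : ℝ)) y) ν' := q1.add iM
    rw [integral_add q2 iS, integral_add q1 iM, integral_add iA iB,
      integral_indicator mA, integral_indicator mB, integral_indicator mM, integral_indicator mS,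
      setIntegral_const]
    simp only [smul_eq_mul, Measure.real]
    ring
  have tA := avg_L1_aux ν' ρ hi A (ρ (-(m : ℝ)))
  have tB := avg_L1_aux ν' ρ hi B (ρ (m : ℝ))
  have i1 : Integrable (fun y => |ρ y - ρ (-(m : ℝ))|) ν' := (hi.sub (integrable_const _)).abs
  have i2 : Integrable (fun y => |ρ y - ρ (m : ℝ)|) ν' := (hi.sub (integrable_const _)).abs
  have tT : ∫ y in A, |ρ y - ρ (-(m : ℝ))| ∂ν' + ∫ y in B, |ρ y - ρ (m : ℝ)| ∂ν'
      ≤ ∫ y in T, (K + L * |y|) ∂ν' := by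
    rw [← integral_indicator mA, ← integral_indicator mB, ← integral_indicator mT,
      ← integral_add (i1.indicator mA) (i2.indicator mB)]
    refine integral_mono ((i1.indicator mA).add (i2.indicator mB)) (hKL.indicator mT) ?_
    intro y
    have nT : 0 ≤ T.indicator (fun y => K + L * |y|) y :=
      Set.indicator_nonneg (fun _ _ => by positivity) y
    show A.indicator (fun y => |ρ y - ρ (-(m : ℝ))|) y + B.indicator (fun y => |ρ y - ρ (m : ℝ)|) y
      ≤ T.indicator (fun y => K + L * |y|) y
    by_cases h2 : y ∈ B
    · have h2' : (m : ℝ) < y := h2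
      have h1 : y ∉ A := fun h => by
        have : y ≤ -(m : ℝ) := h
        linarith
      have h3 : y ∈ T := lt_of_lt_of_le h2' (le_abs_self y)
      rw [Set.indicator_of_notMem h1, Set.indicator_of_mem h2, Set.indicator_of_mem h3, zero_add]
      refine (hLip _ _).trans ?_
      have : L * |y - m| ≤ L * |y| := by
        refine mul_le_mul_of_nonneg_left ?_ hL.le
        rw [abs_of_pos (by linarith), abs_of_pos (by linarith)]
        linarith
      linarith
    rw [Set.indicator_of_notMem h2, add_zero]
    by_cases h1 : y ∈ A
    · have h1' : y ≤ -(m : ℝ) := h1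
      rw [Set.indicator_of_mem h1]
      rcases h1'.eq_or_lt with h | h
      · rw [h, sub_self, abs_zero, ← h]; exact nT
      · have h3 : y ∈ T := lt_of_lt_of_le (by linarith) (neg_le_abs y)
        rw [Set.indicator_of_mem h3]
        refine (hLip _ _).trans ?_
        have : L * |y - -m| ≤ L * |y| := by
          refine mul_le_mul_of_nonneg_left ?_ hL.le
          rw [abs_of_neg (by linarith), abs_of_neg (by linarith)]
          linarith
        linarith
    · rw [Set.indicator_of_notMem h1]; exact nT
  rw [e1] at key
  linarith
end

section
/- Let 0 < α < 1, let C₁, C₂ > 0 and let 0 < ε ≤ M. Let ν̃ be the measure on ℝ with Lebesgue density g̃(y) = C₁ e^{−ε|y|} |y|^{−1−α} for y < 0 and g̃(y) = C₂ e^{−εy} y^{−1−α} for y > 0. For λ₁, λ₂ ∈ [ε, M], let ρ_{λ₁,λ₂}(y) = e^{−(λ₁−ε)|y|} for y < 0 and ρ_{λ₁,λ₂}(y) = e^{−(λ₂−ε)y} for y > 0, and let ρ̄_{λ₁,λ₂,m} be the grid discretization of ρ_{λ₁,λ₂} with respect to ν̃. Then lim_{m→∞} sup_{λ₁,λ₂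 ∈ [ε,M]} ∫_ℝ |ρ_{λ₁,λ₂}(y) − ρ̄_{λ₁,λ₂,m}(y)| ν̃(dy) = 0. -/
open MeasureTheory

/-- The dominating measure of Example 3: Lebesgue measure with density
`C₁ e^{-ε|y|} |y|^{-1-α}` for `y < 0` and `C₂ e^{-εy} y^{-1-α}` for `y > 0`. -/
noncomputable def temperedDom (α C₁ C₂ ε : ℝ) : Measure ℝ :=
  volume.withDensity (fun y =>
    ENNReal.ofReal
      (if y < 0 then C₁ * Real.exp (-(ε * |y|)) * |y| ^ (-(1 + α))
       else C₂ * Real.exp (-(ε * y)) * y ^ (-(1 + α))))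

/-- The density `ρ_{λ₁,λ₂}` of the tempered stable Lévy measure with respect to the
dominating measure: `e^{-(λ₁-ε)|y|}` for `y < 0` and `e^{-(λ₂-ε)y}` for `y ≥ 0`. -/
noncomputable def temperedRho (ε l₁ l₂ : ℝ) (y : ℝ) : ℝ :=
  if y < 0 then Real.exp (-((l₁ - ε) * |y|)) else Real.exp (-((l₂ - ε) * y))

lemma aux_exp (a b : ℝ) (ha : 0 ≤ a) (hb : 0 ≤ b) :
    |Real.exp (-a) - Real.exp (-b)| ≤ |a - b| := by
  wlog h : a ≤ b generalizing a b
  · rw [abs_sub_comm, abs_sub_comm a b]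
    exact this b a hb ha (le_of_not_ge h)
  have h1 : Real.exp (-b) ≤ Real.exp (-a) := Real.exp_le_exp.2 (by linarith)
  rw [abs_of_nonneg (by linarith), abs_of_nonpos (by linarith)]
  have h2 : Real.exp (-b) = Real.exp (-a) * Real.exp (-(b - a)) := by
    rw [← Real.exp_add]; congr 1; ring
  have h3 := Real.add_one_le_exp (-(b - a))
  have h4 : Real.exp (-a) ≤ 1 := Real.exp_le_one_iff.2 (by linarith)
  have h5 := Real.exp_pos (-a)
  rw [h2]
  nlinarith

lemma aux_cell (m : ℕ) (hm : 1 ≤ m) (y : ℝ)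
    (hy : y ∉ Set.Ioc (-(1 / (m : ℝ))) (1 / (m : ℝ))) :
    ((y ≤ -(1 / (m : ℝ)) ∧ ∀ z ∈ gridCell m y, z ≤ -(1 / (m : ℝ))) ∨
      (1 / (m : ℝ) ≤ y ∧ ∀ z ∈ gridCell m y, 1 / (m : ℝ) ≤ z)) ∧
    ((m : ℝ) ≤ |y| ∨ ∀ z ∈ gridCell m y, |y - z| ≤ 1 / m) ∧
    volume (gridCell m y) ≠ 0 := by
  have hm1 : (1 : ℝ) ≤ m := by exact_mod_cast hm
  have hm0 : (0 : ℝ) < m := by linarith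
  have hinv : 1 / (m : ℝ) ≤ m := by
    rw [div_le_iff₀ hm0]; nlinarith
  have hinv0 : 0 < 1 / (m : ℝ) := by positivity
  unfold gridCell
  split_ifs with h1 h2
  · refine ⟨Or.inl ⟨by linarith, fun z hz => ?_⟩, Or.inl ?_, by simp⟩
    · have : z ≤ -(m : ℝ) := hz
      linarith
    · rw [abs_of_nonpos (by linarith)]; linarith
  · refine ⟨Or.inr ⟨by linarith, fun z hz => ?_⟩, Or.inl ?_, by simp⟩
    · have : (m : ℝ) < z := hz
      linarith
    · rw [abs_of_nonneg (by linarith)]; linarith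
  · have hc1 := Int.le_ceil ((m : ℝ) * y)
    have hc2 := Int.ceil_lt_add_one ((m : ℝ) * y)
    have e1 : ∀ i z : ℝ, (i - 1) / m < z ↔ i - 1 < m * z := fun i z => by
      rw [div_lt_iff₀ hm0, mul_comm]
    have e2 : ∀ i z : ℝ, z ≤ i / m ↔ m * z ≤ i := fun i z => by
      rw [le_div_iff₀ hm0, mul_comm]
    have key : m * (1 / (m : ℝ)) = 1 := by field_simp
    refine ⟨?_, Or.inr fun z hz => ?_, ?_⟩
    · rw [Set.mem_Ioc, not_and_or, not_lt, not_le] at hy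
      rcases hy with hy | hy
      · refine Or.inl ⟨hy, fun z hz => ?_⟩
        have : ⌈(m : ℝ) * y⌉ ≤ -1 := by
          rw [Int.ceil_le]; push_cast; nlinarith
        have h' : (⌈(m : ℝ) * y⌉ : ℝ) ≤ -1 := by exact_mod_cast this
        have := (e2 _ _).1 hz.2
        by_contra hcon
        push Not at hcon
        nlinarith
      · refine Or.inr ⟨hy.le, fun z hz => ?_⟩
        have : 1 < ⌈(m : ℝ) * y⌉ := by
          rw [Int.lt_ceil]; push_cast; nlinarith
        have h' : (2 : ℝ) ≤ (⌈(m : ℝ) * y⌉ : ℝ) := by exact_mod_cast this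
        have := (e1 _ _).1 hz.1
        by_contra hcon
        push Not at hcon
        nlinarith
    · have a := (e1 _ _).1 hz.1
      have b := (e2 _ _).1 hz.2
      rw [abs_le]
      constructor
      · by_contra hcon
        push Not at hcon
        nlinarith
      · by_contra hcon
        push Not at hcon
        nlinarith
    · rw [Real.volume_Ioc, ← sub_div]
      simp [hm0]

lemma aux_meas (α C₁ C₂ ε : ℝ) : Measurable (fun y : ℝ =>
    ENNReal.ofReal
      (if y < 0 then C₁ * Real.exp (-(ε * |y|)) * |y| ^ (-(1 + α))
       else C₂ * Real.exp (-(ε * y)) * y ^ (-(1 + α)))) := by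
  apply Measurable.ennreal_ofReal
  refine Measurable.ite measurableSet_Iio ?_ ?_
  · fun_prop
  · fun_prop

lemma aux_ac (α C₁ C₂ ε : ℝ) (hC₁ : 0 < C₁) (hC₂ : 0 < C₂) :
    (volume : Measure ℝ) ≪ temperedDom α C₁ C₂ ε := by
  refine withDensity_absolutelyContinuous' (aux_meas α C₁ C₂ ε).aemeasurable ?_
  have : ∀ᵐ y : ℝ, y ≠ 0 := Measure.ae_ne volume 0
  filter_upwards [this] with y hy
  rw [ne_eq, ENNReal.ofReal_eq_zero, not_le]
  split_ifs with h
  · have : 0 < |y| := abs_pos.2 hy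
    positivity
  · have : 0 < y := lt_of_le_of_ne (not_lt.1 h) hy.symm
    positivity

lemma aux_int (α C₁ C₂ ε : ℝ) (hα0 : 0 < α) (hα1 : α < 1)
    (hC₁ : 0 < C₁) (hC₂ : 0 < C₂) (hε : 0 < ε) :
    Integrable (fun y : ℝ => |y| ^ ((1 + α) / 2)) (temperedDom α C₁ C₂ ε) := by
  unfold temperedDom
  rw [integrable_withDensity_iff (aux_meas α C₁ C₂ ε) (by simp)]
  have h0 : IntegrableOn (fun x : ℝ => |x| ^ (-((1 + α) / 2)) * Real.exp (-(ε * |x|)))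
      (Set.Ioi 0) := by
    have := integrableOn_rpow_mul_exp_neg_mul_rpow (p := 1) (s := -((1 + α) / 2)) (b := ε)
      (by linarith) one_pos hε
    refine this.congr_fun (fun x hx => ?_) measurableSet_Ioi
    have hx : 0 < x := hx
    simp only [abs_of_pos hx, Real.rpow_one, neg_mul]
  have h1 : Integrable (fun x : ℝ => |x| ^ (-((1 + α) / 2)) * Real.exp (-(ε * |x|))) := by
    rw [← integrableOn_univ, ← Set.Iic_union_Ioi (a := (0 : ℝ)), integrableOn_union]
    refine ⟨?_, h0⟩
    have := (integrableOn_Ici_iff_integrableOn_Ioi (μ := volume)).2 h0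
    have h2 := this.comp_neg
    simpa using h2
  refine (h1.const_mul (C₁ + C₂)).mono' ?_ ?_
  · exact (Measurable.mul (by fun_prop) (aux_meas α C₁ C₂ ε).ennreal_toReal).aestronglyMeasurable
  · have : ∀ᵐ y : ℝ, y ≠ 0 := Measure.ae_ne volume 0
    filter_upwards [this] with y hy
    have hp : 0 < |y| := abs_pos.2 hy
    have e : |y| ^ (-((1 + α) / 2)) = |y| ^ ((1 + α) / 2) * |y| ^ (-(1 + α)) := by
      rw [← Real.rpow_add hp]; congr 1; ring
    rw [e]
    have hh : (if y < 0 then C₁ * Real.exp (-(ε * |y|)) * |y| ^ (-(1 + α))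
       else C₂ * Real.exp (-(ε * y)) * y ^ (-(1 + α)))
       = (if y < 0 then C₁ else C₂) * (Real.exp (-(ε * |y|)) * |y| ^ (-(1 + α))) := by
      split_ifs with h
      · ring
      · rw [abs_of_nonneg (not_lt.1 h)]; ring
    rw [hh]
    have hC : 0 < (if y < 0 then C₁ else C₂) ∧ (if y < 0 then C₁ else C₂) ≤ C₁ + C₂ := by
      split_ifs <;> constructor <;> linarith
    have hq : 0 < |y| ^ ((1 + α) / 2) * (Real.exp (-(ε * |y|)) * |y| ^ (-(1 + α))) := by
      positivity
    have hq' : 0 < (if y < 0 then C₁ else C₂) * (Real.exp (-(ε * |y|)) * |y| ^ (-(1 + α))) :=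
      mul_pos hC.1 (by positivity)
    rw [ENNReal.toReal_ofReal hq'.le, Real.norm_of_nonneg (by positivity)]
    calc _ = (if y < 0 then C₁ else C₂) *
          (|y| ^ ((1 + α) / 2) * (Real.exp (-(ε * |y|)) * |y| ^ (-(1 + α)))) := by ring
      _ ≤ (C₁ + C₂) * (|y| ^ ((1 + α) / 2) * (Real.exp (-(ε * |y|)) * |y| ^ (-(1 + α)))) :=
          mul_le_mul_of_nonneg_right hC.2 hq.le
      _ = _ := by ring

lemma aux_avg (ν : Measure ℝ) (J : Set ℝ) (h0 : ν J ≠ 0) (hfin : ν J < ⊤) (f : ℝ → ℝ)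
    (hf : Measurable f) (hb : ∀ z, |f z| ≤ 1) (c B : ℝ) (h : ∀ z ∈ J, |c - f z| ≤ B) :
    |c - (∫ z in J, f z ∂ν) / (ν J).toReal| ≤ B := by
  have hp : 0 < (ν J).toReal := ENNReal.toReal_pos h0 hfin.ne
  have hi : IntegrableOn f J ν := Measure.integrableOn_of_bounded hfin.ne
    hf.aestronglyMeasurable (M := 1) (Filter.Eventually.of_forall hb)
  have hc : IntegrableOn (fun _ : ℝ => c) J ν := integrableOn_const hfin.ne
  have h1 := norm_setIntegral_le_of_norm_le_const (μ := ν) (f := fun z => c - f z) hfin h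
  rw [integral_sub hc hi, setIntegral_const, Real.norm_eq_abs, smul_eq_mul] at h1
  have e : c - (∫ z in J, f z ∂ν) / (ν J).toReal
      = (ν.real J * c - ∫ z in J, f z ∂ν) / (ν J).toReal := by
    rw [Measure.real]; field_simp
  rw [e, abs_div, abs_of_pos hp, div_le_iff₀ hp]
  exact h1

lemma aux_rho_meas (ε a b : ℝ) : Measurable (temperedRho ε a b) := by
  unfold temperedRho
  refine Measurable.ite measurableSet_Iio ?_ ?_
  · fun_prop
  · fun_prop

lemma aux_rho_range (ε a b : ℝ) (ha : ε ≤ a) (hb : ε ≤ b) (y : ℝ) :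
    0 < temperedRho ε a b y ∧ temperedRho ε a b y ≤ 1 := by
  unfold temperedRho
  split_ifs with h
  · refine ⟨Real.exp_pos _, Real.exp_le_one_iff.2 ?_⟩
    have := mul_nonneg (sub_nonneg.2 ha) (abs_nonneg y)
    linarith
  · refine ⟨Real.exp_pos _, Real.exp_le_one_iff.2 ?_⟩
    have := mul_nonneg (sub_nonneg.2 hb) (not_lt.1 h)
    linarith

lemma aux_rho_lip (ε M a b : ℝ) (ha : a ∈ Set.Icc ε M) (hb : b ∈ Set.Icc ε M) (y z : ℝ)
    (h : (y < 0 ∧ z < 0) ∨ (0 ≤ y ∧ 0 ≤ z)) :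
    |temperedRho ε a b y - temperedRho ε a b z| ≤ (M - ε) * |y - z| := by
  obtain ⟨ha1, ha2⟩ := ha
  obtain ⟨hb1, hb2⟩ := hb
  unfold temperedRho
  rcases h with ⟨h1, h2⟩ | ⟨h1, h2⟩
  · rw [if_pos h1, if_pos h2]
    refine (aux_exp _ _ (mul_nonneg (sub_nonneg.2 ha1) (abs_nonneg y))
      (mul_nonneg (sub_nonneg.2 ha1) (abs_nonneg z))).trans ?_
    rw [← mul_sub, abs_mul, abs_of_nonneg (sub_nonneg.2 ha1)]
    exact mul_le_mul (by linarith) (abs_abs_sub_abs_le y z) (abs_nonneg _) (by linarith)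
  · rw [if_neg (not_lt.2 h1), if_neg (not_lt.2 h2)]
    refine (aux_exp _ _ (mul_nonneg (sub_nonneg.2 hb1) h1)
      (mul_nonneg (sub_nonneg.2 hb1) h2)).trans ?_
    rw [← mul_sub, abs_mul, abs_of_nonneg (sub_nonneg.2 hb1)]
    exact mul_le_mul (by linarith) le_rfl (abs_nonneg _) (by linarith)

lemma aux_rho_one (ε M a b : ℝ) (ha : a ∈ Set.Icc ε M) (hb : b ∈ Set.Icc ε M) (y : ℝ) :
    |temperedRho ε a b y - 1| ≤ (M - ε) * |y| := by
  obtain ⟨ha1, ha2⟩ := ha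
  obtain ⟨hb1, hb2⟩ := hb
  have h0 : (1 : ℝ) = Real.exp (-0) := by simp
  unfold temperedRho
  split_ifs with h
  · have h3 := mul_nonneg (sub_nonneg.2 ha1) (abs_nonneg y)
    rw [h0]
    refine (aux_exp _ _ h3 le_rfl).trans ?_
    rw [sub_zero, abs_of_nonneg h3]
    exact mul_le_mul_of_nonneg_right (by linarith) (abs_nonneg _)
  · have h3 := mul_nonneg (sub_nonneg.2 hb1) (not_lt.1 h)
    rw [h0]
    refine (aux_exp _ _ h3 le_rfl).trans ?_
    rw [sub_zero, abs_of_nonneg h3, abs_of_nonneg (not_lt.1 h)]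
    exact mul_le_mul_of_nonneg_right (by linarith) (not_lt.1 h)

lemma aux_bound (α C₁ C₂ ε M : ℝ) (hα0 : 0 < α) (hα1 : α < 1)
    (hC₁ : 0 < C₁) (hC₂ : 0 < C₂) (hε : 0 < ε) (hεM : ε ≤ M)
    (a b : ℝ) (ha : a ∈ Set.Icc ε M) (hb : b ∈ Set.Icc ε M) (m : ℕ) (hm : 1 ≤ m) (y : ℝ) :
    |temperedRho ε a b y - gridDisc m (temperedDom α C₁ C₂ ε) (temperedRho ε a b) y| ≤
      (M - ε) / m * (m * |y|) ^ ((1 + α) / 2) + (|y| / m) ^ ((1 + α) / 2) := by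
  have hm1 : (1 : ℝ) ≤ m := by exact_mod_cast hm
  have hm0 : (0 : ℝ) < m := by linarith
  have hK : 0 ≤ M - ε := by linarith
  have hinv0 : 0 < 1 / (m : ℝ) := by positivity
  have key : m * (1 / (m : ℝ)) = 1 := by field_simp
  have p1 : 0 ≤ (M - ε) / m * (m * |y|) ^ ((1 + α) / 2) := by positivity
  have p2 : 0 ≤ (|y| / m) ^ ((1 + α) / 2) := by positivity
  unfold gridDisc
  by_cases hy : y ∈ Set.Ioc (-(1 / (m : ℝ))) (1 / (m : ℝ))
  · rw [if_pos hy]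
    have hy' : |y| ≤ 1 / m := abs_le.2 ⟨hy.1.le, hy.2⟩
    refine (aux_rho_one ε M a b ha hb y).trans ?_
    have hmy : m * |y| ≤ 1 := by rw [← key]; gcongr
    have h1 : m * |y| ≤ (m * |y|) ^ ((1 + α) / 2) :=
      Real.self_le_rpow_of_le_one (by positivity) hmy (by linarith)
    have h2 : (M - ε) * |y| = (M - ε) / m * (m * |y|) := by field_simp
    have h3 := mul_le_mul_of_nonneg_left h1 (div_nonneg hK hm0.le)
    linarith
  · rw [if_neg hy]
    obtain ⟨hs, hd, hv⟩ := aux_cell m hm y hy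
    have hn0 : temperedDom α C₁ C₂ ε (gridCell m y) ≠ 0 := fun h =>
      hv (aux_ac α C₁ C₂ ε hC₁ hC₂ h)
    rw [if_neg hn0]
    have hy1 : 1 / (m : ℝ) ≤ |y| := by
      rcases hs with hs | hs
      · rw [le_abs]; right; linarith [hs.1]
      · rw [le_abs]; left; exact hs.1
    have hz1 : ∀ z ∈ gridCell m y, 1 / (m : ℝ) ≤ |z| := by
      intro z hz
      rcases hs with hs | hs
      · rw [le_abs]; right; linarith [hs.2 z hz]
      · rw [le_abs]; left; exact hs.2 z hz
    have hfin : temperedDom α C₁ C₂ ε (gridCell m y) < ⊤ := by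
      refine lt_of_le_of_lt (measure_mono ?_)
        ((aux_int α C₁ C₂ ε hα0 hα1 hC₁ hC₂ hε).measure_norm_ge_lt_top
          (ε := (1 / (m : ℝ)) ^ ((1 + α) / 2)) (by positivity))
      intro z hz
      show _ ≤ ‖_‖
      rw [Real.norm_of_nonneg (by positivity)]
      exact Real.rpow_le_rpow hinv0.le (hz1 z hz) (by linarith)
    refine aux_avg _ _ hn0 hfin _ (aux_rho_meas ε a b) (fun z => ?_) _ _ fun z hz => ?_
    · have := aux_rho_range ε a b ha.1 hb.1 z
      rw [abs_of_pos this.1]; exact this.2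
    · rcases hd with hd | hd
      · have r1 := aux_rho_range ε a b ha.1 hb.1 z
        have r2 := aux_rho_range ε a b ha.1 hb.1 y
        have h1 : |temperedRho ε a b y - temperedRho ε a b z| ≤ 1 := by
          rw [abs_le]; constructor <;> linarith [r1.1, r1.2, r2.1, r2.2]
        have h2 : 1 ≤ (|y| / m) ^ ((1 + α) / 2) :=
          Real.one_le_rpow ((one_le_div hm0).2 hd) (by linarith)
        linarith
      · have h1 := aux_rho_lip ε M a b ha hb y z (by
          rcases hs with hs | hs
          · left; constructor <;> linarith [hs.1, hs.2 z hz]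
          · right; constructor <;> linarith [hs.1, hs.2 z hz])
        have h2 : 1 ≤ (m * |y|) ^ ((1 + α) / 2) :=
          Real.one_le_rpow (by rw [← key]; gcongr) (by linarith)
        have h3 := mul_le_mul_of_nonneg_left (hd z hz) hK
        have h4 := mul_le_mul_of_nonneg_left h2 (div_nonneg hK hm0.le)
        have h5 : (M - ε) * (1 / m) = (M - ε) / m * 1 := by ring
        linarith

/-- Condition (M3) for Example 3 (tempered stable Lévy measures): the `L¹(ν̃)` distance
between `ρ_{λ₁,λ₂}` and its grid discretization tends to `0` as `m → ∞`, uniformly over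
`λ₁, λ₂ ∈ [ε, M]`. -/
theorem tendsto_iSup_integral_abs_tempered_sub_gridDisc
    (α C₁ C₂ ε M : ℝ) (hα0 : 0 < α) (hα1 : α < 1)
    (hC₁ : 0 < C₁) (hC₂ : 0 < C₂) (hε : 0 < ε) (hεM : ε ≤ M) :
    Filter.Tendsto
      (fun m : ℕ =>
        ⨆ p : Set.Icc ε M × Set.Icc ε M,
          ∫ y, |temperedRho ε (p.1 : ℝ) (p.2 : ℝ) y -
              gridDisc m (temperedDom α C₁ C₂ ε) (temperedRho ε (p.1 : ℝ) (p.2 : ℝ)) y|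
            ∂(temperedDom α C₁ C₂ ε))
      Filter.atTop (nhds 0) := by
  have hint := aux_int α C₁ C₂ ε hα0 hα1 hC₁ hC₂ hε
  set I := ∫ y, |y| ^ ((1 + α) / 2) ∂(temperedDom α C₁ C₂ ε) with hI
  have hlim : Filter.Tendsto (fun m : ℕ => ((M - ε) * (m : ℝ) ^ (-((1 - α) / 2)) +
      (m : ℝ) ^ (-((1 + α) / 2))) * I) Filter.atTop (nhds 0) := by
    have t1 := (tendsto_rpow_neg_atTop (y := (1 - α) / 2) (by linarith)).comp
      (tendsto_natCast_atTop_atTop (R := ℝ))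
    have t2 := (tendsto_rpow_neg_atTop (y := (1 + α) / 2) (by linarith)).comp
      (tendsto_natCast_atTop_atTop (R := ℝ))
    have := ((t1.const_mul (M - ε)).add t2).mul_const I
    simpa using this
  haveI : Nonempty (Set.Icc ε M × Set.Icc ε M) :=
    ⟨(⟨ε, le_rfl, hεM⟩, ⟨ε, le_rfl, hεM⟩)⟩
  refine squeeze_zero' (Filter.Eventually.of_forall fun m => ?_) ?_ hlim
  · exact Real.iSup_nonneg fun p => integral_nonneg fun y => abs_nonneg _
  · filter_upwards [Filter.eventually_ge_atTop 1] with m hm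
    have hm0 : (0 : ℝ) < m := by exact_mod_cast hm
    refine ciSup_le fun p => ?_
    rw [hI, ← integral_const_mul]
    refine integral_mono_of_nonneg (Filter.Eventually.of_forall fun y => abs_nonneg _)
      (hint.const_mul _) (Filter.Eventually.of_forall fun y => ?_)
    refine (aux_bound α C₁ C₂ ε M hα0 hα1 hC₁ hC₂ hε hεM p.1 p.2 p.1.2 p.2.2 m hm y).trans
      (le_of_eq ?_)
    have e : (m : ℝ) ^ (-((1 - α) / 2)) = (m : ℝ) ^ ((1 + α) / 2) / m := by
      rw [← Real.rpow_sub_one hm0.ne']; congr 1; ring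
    rw [Real.mul_rpow hm0.le (abs_nonneg y), Real.div_rpow (abs_nonneg y) hm0.le, e,
      Real.rpow_neg hm0.le]
    ring
end
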